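/- arXiv:1912.00014 — 3 statements merged into one kernel-verified Lean document; each statement's English description precedes it below -/
import Mathlib

section
/- (Weierstrass-type representation) Let x : D → ℝ⁴ be a minimal time-like surface in isothermal coordinates with E < 0 (so x_uu = x_vv). Then every point of D has an open neighborhood D₀ on which there exists a smooth map y : D₀ → ℝ⁴ with y_u = x_v and y_v = x_u. Conversely, if x, y : D → ℝ⁴ are C² maps on an open set D ⊆ ℝ² satisfying y_u = x_v, y_v = x_u, and at every point ⟨x_u,x_u⟩ + ⟨x_v,x_v⟩ = 0, ⟨x_u,x_v⟩ = 0, ⟨x_u,x_u⟩ < 0, then x is a minimal time-like surface in isothermal coordinates with E < 0. -/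
noncomputable section

abbrev V4 : Type := Fin 4 → ℝ

/-- The indefinite scalar product of `ℝ⁴₂`. -/
def ip (a b : V4) : ℝ := -(a 0 * b 0) + a 1 * b 1 - a 2 * b 2 + a 3 * b 3

/-- Partial derivative w.r.t. the first variable. -/
def pu {E : Type*} [NormedAddCommGroup E] [NormedSpace ℝ E]
    (f : ℝ × ℝ → E) (p : ℝ × ℝ) : E := fderiv ℝ f p (1, 0)

/-- Partial derivative w.r.t. the second variable. -/
def pv {E : Type*} [NormedAddCommGroup E] [NormedSpace ℝ E]
    (f : ℝ × ℝ → E) (p : ℝ × ℝ) : E := fderiv ℝ f p (0, 1)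

/-- `E`, the first coefficient of the first fundamental form. -/
def Ef (x : ℝ × ℝ → V4) (p : ℝ × ℝ) : ℝ := ip (pu x p) (pu x p)

/-- Normal projection of a vector `w` at the point `p` of the surface `x`:
`w^⊥ = w − (⟨w,x_u⟩/E)·x_u + (⟨w,x_v⟩/E)·x_v`. -/
def nproj (x : ℝ × ℝ → V4) (w : V4) (p : ℝ × ℝ) : V4 :=
  w - (ip w (pu x p) / Ef x p) • pu x p + (ip w (pv x p) / Ef x p) • pv x p

/-- `a = (x_uu)^⊥`. -/
def sffA (x : ℝ × ℝ → V4) (p : ℝ × ℝ) : V4 := nproj x (pu (pu x) p) p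

/-- `b = (x_uv)^⊥`. -/
def sffB (x : ℝ × ℝ → V4) (p : ℝ × ℝ) : V4 := nproj x (pv (pu x) p) p

/-- Determinant of the 4×4 matrix with columns `v1, v2, v3, v4`. -/
def det4 (v1 v2 v3 v4 : V4) : ℝ := (Matrix.of ![v1, v2, v3, v4]).transpose.det

/-- The Gauss curvature `K = (⟨b,b⟩ − ⟨a,a⟩)/E²`. -/
def GaussK (x : ℝ × ℝ → V4) (p : ℝ × ℝ) : ℝ :=
  (ip (sffB x p) (sffB x p) - ip (sffA x p) (sffA x p)) / (Ef x p) ^ 2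

/-- The curvature of the normal connection `ϰ = −2·det[x_u,x_v,a,b]/E³`. -/
def NormK (x : ℝ × ℝ → V4) (p : ℝ × ℝ) : ℝ :=
  -2 * det4 (pu x p) (pv x p) (sffA x p) (sffB x p) / (Ef x p) ^ 3

/-- The hyperbolic Laplacian `Δʰ f = f_uu − f_vv`. -/
def hlap (f : ℝ × ℝ → ℝ) (p : ℝ × ℝ) : ℝ := pu (pu f) p - pv (pv f) p

/-- Time-like surface in isothermal coordinates with `E < 0`. -/
def IsTimelikeIso (D : Set (ℝ × ℝ)) (x : ℝ × ℝ → V4) : Prop :=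
  ∀ p ∈ D, Ef x p < 0 ∧ ip (pv x p) (pv x p) = -(Ef x p) ∧ ip (pu x p) (pv x p) = 0

/-- Minimality: `x_uu − x_vv = 0`. -/
def IsMinimal (D : Set (ℝ × ℝ)) (x : ℝ × ℝ → V4) : Prop :=
  ∀ p ∈ D, pu (pu x) p - pv (pv x) p = 0

/-- Degenerate point: `(⟨a,a⟩+⟨b,b⟩)² = 4⟨a,b⟩²`. -/
def DegeneratePt (x : ℝ × ℝ → V4) (p : ℝ × ℝ) : Prop :=
  (ip (sffA x p) (sffA x p) + ip (sffB x p) (sffB x p)) ^ 2 =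
    4 * (ip (sffA x p) (sffB x p)) ^ 2

/-- Surface of the first type. -/
def FirstType (D : Set (ℝ × ℝ)) (x : ℝ × ℝ → V4) : Prop :=
  ∀ p ∈ D,
    (ip (sffA x p) (sffA x p) + ip (sffB x p) (sffB x p)) ^ 2 -
      4 * (ip (sffA x p) (sffB x p)) ^ 2 > 0 ∧
    ip (sffA x p) (sffA x p) + ip (sffB x p) (sffB x p) > 0

/-- Surface of the second type. -/
def SecondType (D : Set (ℝ × ℝ)) (x : ℝ × ℝ → V4) : Prop :=
  ∀ p ∈ D,
    (ip (sffA x p) (sffA x p) + ip (sffB x p) (sffB x p)) ^ 2 -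
      4 * (ip (sffA x p) (sffB x p)) ^ 2 > 0 ∧
    ip (sffA x p) (sffA x p) + ip (sffB x p) (sffB x p) < 0

/-- Surface of the third type. -/
def ThirdType (D : Set (ℝ × ℝ)) (x : ℝ × ℝ → V4) : Prop :=
  ∀ p ∈ D,
    (ip (sffA x p) (sffA x p) + ip (sffB x p) (sffB x p)) ^ 2 -
      4 * (ip (sffA x p) (sffB x p)) ^ 2 < 0

/-- Canonical coordinates with parameters `(e0, e1)`:
`⟨a,a⟩+⟨b,b⟩ = e0` and `2⟨a,b⟩ = e1` identically. -/
def Canonical (D : Set (ℝ × ℝ)) (x : ℝ × ℝ → V4) (e0 e1 : ℝ) : Prop :=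
  ∀ p ∈ D,
    ip (sffA x p) (sffA x p) + ip (sffB x p) (sffB x p) = e0 ∧
    2 * ip (sffA x p) (sffB x p) = e1

section PartialDerivatives

variable {E : Type*} [NormedAddCommGroup E] [NormedSpace ℝ E]

lemma ContDiffOn.differentiableAt_fderiv {f : ℝ × ℝ → E} {D : Set (ℝ × ℝ)}
    (hD : IsOpen D) (hf : ContDiffOn ℝ 2 f D) {p : ℝ × ℝ} (hp : p ∈ D) :
    DifferentiableAt ℝ (fderiv ℝ f) p :=
  ((hf.fderiv_of_isOpen hD (m := 1) (by norm_num)).contDiffAt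
    (hD.mem_nhds hp)).differentiableAt (by norm_num)

lemma pu_fderiv_apply {f : ℝ × ℝ → E} {p : ℝ × ℝ}
    (hf : DifferentiableAt ℝ (fderiv ℝ f) p) (w : ℝ × ℝ) :
    pu (fun q ↦ fderiv ℝ f q w) p = fderiv ℝ (fderiv ℝ f) p (1, 0) w := by
  rw [pu, fderiv_clm_apply hf (differentiableAt_const w)]
  simp

lemma pv_fderiv_apply {f : ℝ × ℝ → E} {p : ℝ × ℝ}
    (hf : DifferentiableAt ℝ (fderiv ℝ f) p) (w : ℝ × ℝ) :
    pv (fun q ↦ fderiv ℝ f q w) p = fderiv ℝ (fderiv ℝ f) p (0, 1) w := by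
  rw [pv, fderiv_clm_apply hf (differentiableAt_const w)]
  simp

lemma pu_congr {f g : ℝ × ℝ → E} {D : Set (ℝ × ℝ)} (hD : IsOpen D)
    (h : ∀ q ∈ D, f q = g q) {p : ℝ × ℝ} (hp : p ∈ D) : pu f p = pu g p := by
  rw [pu, pu, (Filter.eventuallyEq_of_mem (hD.mem_nhds hp) h).fderiv_eq]

lemma pv_congr {f g : ℝ × ℝ → E} {D : Set (ℝ × ℝ)} (hD : IsOpen D)
    (h : ∀ q ∈ D, f q = g q) {p : ℝ × ℝ} (hp : p ∈ D) : pv f p = pv g p := by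
  rw [pv, pv, (Filter.eventuallyEq_of_mem (hD.mem_nhds hp) h).fderiv_eq]

/-- Mixed partial derivatives of a `C²` function commute. -/
lemma pu_pv_eq_pv_pu {f : ℝ × ℝ → E} {D : Set (ℝ × ℝ)} (hD : IsOpen D)
    (hf : ContDiffOn ℝ 2 f D) {p : ℝ × ℝ} (hp : p ∈ D) :
    pu (pv f) p = pv (pu f) p := by
  have hd := hf.differentiableAt_fderiv hD hp
  have hsymm : IsSymmSndFDerivAt ℝ f p :=
    (hf.contDiffAt (hD.mem_nhds hp)).isSymmSndFDerivAt (by simp)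
  exact (pu_fderiv_apply hd (0, 1)).trans
    ((hsymm.eq (1, 0) (0, 1)).trans (pv_fderiv_apply hd (1, 0)).symm)

/-- If `B ((1, 0), (1, 0)) = B ((0, 1), (0, 1))`, then the bilinear map
`(h, k) ↦ B (h, k.swap)` is symmetric. -/
lemma apply_swap_comm (B : ℝ × ℝ →L[ℝ] ℝ × ℝ →L[ℝ] E)
    (hB : B (1, 0) (1, 0) = B (0, 1) (0, 1)) (h k : ℝ × ℝ) :
    B h k.swap = B k h.swap := by
  have hdecomp (a b : ℝ) : (a, b) = a • ((1, 0) : ℝ × ℝ) + b • ((0, 1) : ℝ × ℝ) := by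
    ext <;> simp
  obtain ⟨a, b⟩ := h
  obtain ⟨c, d⟩ := k
  rw [Prod.swap_prod_mk, Prod.swap_prod_mk, hdecomp a b, hdecomp c d, hdecomp d c, hdecomp b a]
  simp only [map_add, map_smul, add_apply, smul_apply, hB]
  module

/-- A `C²` solution of `x_uu = x_vv` on a convex open set has a conjugate `y` with
`y_u = x_v` and `y_v = x_u`. -/
lemma exists_conjugate_of_convex [CompleteSpace E] {x : ℝ × ℝ → E} {D : Set (ℝ × ℝ)}
    (hD : IsOpen D) (hconv : Convex ℝ D) (hx : ContDiffOn ℝ 2 x D)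
    (hmin : ∀ p ∈ D, pu (pu x) p = pv (pv x) p) :
    ∃ y : ℝ × ℝ → E, ContDiffOn ℝ 2 y D ∧
      ∀ p ∈ D, pu y p = pv x p ∧ pv y p = pu x p := by
  let J : ℝ × ℝ →L[ℝ] ℝ × ℝ :=
    (ContinuousLinearMap.snd ℝ ℝ ℝ).prod (ContinuousLinearMap.fst ℝ ℝ ℝ)
  let R := (ContinuousLinearMap.compL ℝ (ℝ × ℝ) (ℝ × ℝ) E).flip J
  have hω (p) (hp : p ∈ D) :
      HasFDerivAt (fun q ↦ R (fderiv ℝ x q)) (R.comp (fderiv ℝ (fderiv ℝ x) p)) p :=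
    R.hasFDerivAt.comp p (hx.differentiableAt_fderiv hD hp).hasFDerivAt
  obtain ⟨y, hy⟩ := hconv.exists_forall_hasFDerivAt_of_fderiv_symmetric hD
    (ω := fun q ↦ R (fderiv ℝ x q))
    (fun p hp ↦ (hω p hp).differentiableAt.differentiableWithinAt)
    (fun p hp h k ↦ by
      rw [(hω p hp).fderiv]
      have hd := hx.differentiableAt_fderiv hD hp
      exact apply_swap_comm _ ((pu_fderiv_apply hd (1, 0)).symm.trans
        ((hmin p hp).trans (pv_fderiv_apply hd (0, 1)))) h k)
  refine ⟨y, ?_, fun p hp ↦ ?_⟩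
  · rw [show (2 : WithTop ℕ∞) = 1 + 1 by norm_num, contDiffOn_succ_iff_fderiv_of_isOpen hD]
    refine ⟨fun p hp ↦ (hy p hp).differentiableAt.differentiableWithinAt, by simp, ?_⟩
    exact (R.contDiff.comp_contDiffOn (hx.fderiv_of_isOpen hD (m := 1) (by norm_num))).congr
      fun p hp ↦ (hy p hp).fderiv
  · simp only [pu, pv, (hy p hp).fderiv]
    exact ⟨rfl, rfl⟩

/-- A `C²` map admitting a `C²` conjugate satisfies `x_uu = x_vv`. -/
lemma pu_pu_eq_pv_pv_of_conjugate {x y : ℝ × ℝ → E} {D : Set (ℝ × ℝ)} (hD : IsOpen D)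
    (hy : ContDiffOn ℝ 2 y D) (hxy : ∀ p ∈ D, pu y p = pv x p ∧ pv y p = pu x p)
    {p : ℝ × ℝ} (hp : p ∈ D) : pu (pu x) p = pv (pv x) p :=
  calc pu (pu x) p = pu (pv y) p := pu_congr hD (fun q hq ↦ (hxy q hq).2.symm) hp
    _ = pv (pu y) p := pu_pv_eq_pv_pu hD hy hp
    _ = pv (pv x) p := pv_congr hD (fun q hq ↦ (hxy q hq).1) hp

end PartialDerivatives

/-- Weierstrass-type representation. A minimal time-like surface locally
admits a harmonic conjugate `y` (`y_u = x_v`, `y_v = x_u`); conversely the existence of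
such a `y` together with the algebraic conditions makes `x` a minimal time-like surface
in isothermal coordinates with `E < 0`. -/
theorem stmt_2 :
    (∀ D : Set (ℝ × ℝ), IsOpen D → ∀ x : ℝ × ℝ → V4, ContDiffOn ℝ 2 x D →
      IsTimelikeIso D x → IsMinimal D x →
      ∀ t₀ ∈ D, ∃ D₀ : Set (ℝ × ℝ), IsOpen D₀ ∧ t₀ ∈ D₀ ∧ D₀ ⊆ D ∧
        ∃ y : ℝ × ℝ → V4, ContDiffOn ℝ 2 y D₀ ∧
          ∀ p ∈ D₀, pu y p = pv x p ∧ pv y p = pu x p) ∧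
    (∀ D : Set (ℝ × ℝ), IsOpen D → ∀ x y : ℝ × ℝ → V4,
      ContDiffOn ℝ 2 x D → ContDiffOn ℝ 2 y D →
      (∀ p ∈ D, pu y p = pv x p ∧ pv y p = pu x p) →
      (∀ p ∈ D, ip (pu x p) (pu x p) + ip (pv x p) (pv x p) = 0 ∧
        ip (pu x p) (pv x p) = 0 ∧ ip (pu x p) (pu x p) < 0) →
      IsTimelikeIso D x ∧ IsMinimal D x) := by
  refine ⟨fun D hD x hx _ hmin t₀ ht₀ ↦ ?_, fun D hD x y _ hy hxy halg ↦ ⟨fun p hp ↦ ?_, ?_⟩⟩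
  · obtain ⟨r, hr, hball⟩ := Metric.isOpen_iff.1 hD t₀ ht₀
    exact ⟨Metric.ball t₀ r, Metric.isOpen_ball, Metric.mem_ball_self hr, hball,
      exists_conjugate_of_convex Metric.isOpen_ball (convex_ball t₀ r) (hx.mono hball)
        fun p hp ↦ sub_eq_zero.1 (hmin p (hball hp))⟩
  · obtain ⟨hsum, horth, hneg⟩ := halg p hp
    exact ⟨hneg, eq_neg_of_add_eq_zero_right hsum, horth⟩
  · exact fun p hp ↦ sub_eq_zero.2 (pu_pu_eq_pv_pv_of_conjugate hD hy hxy hp)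
end
end

section
/- Let x : D → ℝ⁴ be a time-like surface in isothermal coordinates with E < 0, let D' ⊆ ℝ² be open and connected, and let F = (p,q) : D' → D be a C¹ diffeomorphism onto its image such that x∘F is also a time-like surface in isothermal coordinates with first coefficient Ẽ := ⟨(x∘F)_u,(x∘F)_u⟩ < 0. Then exactly one of the following holds throughout D': either F satisfies the Cauchy–Riemann equations over the double numbers, q_u = p_v and q_v = p_u, and det(DF) > 0 at every point of D'; or F satisfies q_u = −p_v and q_v = −p_u, and det(DF) < 0 at every point of D'. In other words, the reparametrization is holomorphic over the double numbers if and only if it preserves orientation, and anti-holomorphic if and only if it reverses orientation. -/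
noncomputable section

theorem fderiv_comp_prodMk_apply {E : Type*} [NormedAddCommGroup E] [NormedSpace ℝ E]
    {x : ℝ × ℝ → E} {p q : ℝ × ℝ → ℝ} {s : ℝ × ℝ} (hx : DifferentiableAt ℝ x (p s, q s))
    (hp : DifferentiableAt ℝ p s) (hq : DifferentiableAt ℝ q s) (w : ℝ × ℝ) :
    fderiv ℝ (fun t => x (p t, q t)) s w =
      fderiv ℝ p s w • pu x (p s, q s) + fderiv ℝ q s w • pv x (p s, q s) := by
  have h : HasFDerivAt (fun t => x (p t, q t)) _ s :=
    HasFDerivAt.comp (f := fun t => (p t, q t)) s hx.hasFDerivAt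
      (hp.hasFDerivAt.prodMk hq.hasFDerivAt)
  have hw : ((fderiv ℝ p s w, fderiv ℝ q s w) : ℝ × ℝ) =
      fderiv ℝ p s w • (1, 0) + fderiv ℝ q s w • (0, 1) := by simp
  rw [h.fderiv]
  simp only [ContinuousLinearMap.comp_apply, ContinuousLinearMap.prod_apply]
  rw [hw, map_add, map_smul, map_smul]
  rfl

theorem ip_linear_combination {X Y : V4} {e : ℝ} (hX : ip X X = e) (hY : ip Y Y = -e)
    (hXY : ip X Y = 0) (a b c d : ℝ) :
    ip (a • X + c • Y) (b • X + d • Y) = e * (a * b - c * d) := by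
  simp only [ip, Pi.add_apply, Pi.smul_apply, smul_eq_mul] at *
  linear_combination a * b * hX + c * d * hY + (a * d + b * c) * hXY

/-- A conformal map of the Lorentzian plane preserving the causal character is, at the linear
level, either holomorphic or anti-holomorphic over the double numbers. -/
theorem doubleNumber_cauchyRiemann_or {a b c d : ℝ} (hpos : 0 < a ^ 2 - c ^ 2)
    (heq : b ^ 2 - d ^ 2 = -(a ^ 2 - c ^ 2)) (horth : a * b = c * d) :
    (c = b ∧ d = a ∧ a * d - b * c > 0) ∨ (c = -b ∧ d = -a ∧ a * d - b * c < 0) := by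
  have ha : a ≠ 0 := by
    rintro rfl
    nlinarith [sq_nonneg c]
  have hd : (a ^ 2 - c ^ 2) * ((d - a) * (d + a)) = 0 := by
    linear_combination -a ^ 2 * heq + (a * b + c * d) * horth
  rcases mul_eq_zero.mp ((mul_eq_zero.mp hd).resolve_left hpos.ne') with h | h
  · obtain rfl : d = a := by linarith
    obtain rfl : b = c := mul_left_cancel₀ ha (by linarith)
    exact .inl ⟨rfl, rfl, by nlinarith⟩
  · obtain rfl : d = -a := by linarith
    obtain rfl : b = -c := mul_left_cancel₀ ha (by linarith)
    exact .inr ⟨by ring, rfl, by nlinarith⟩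

theorem IsPreconnected.forall_pos_or_forall_neg {α : Type*} [TopologicalSpace α] {S : Set α}
    (hS : IsPreconnected S) {f : α → ℝ} (hf : ContinuousOn f S) (h0 : ∀ s ∈ S, f s ≠ 0) :
    (∀ s ∈ S, 0 < f s) ∨ (∀ s ∈ S, f s < 0) := by
  by_contra! h
  obtain ⟨⟨s, hs, hfs⟩, t, ht, hft⟩ := h
  obtain ⟨r, hr, hfr⟩ := hS.intermediate_value hs ht hf ⟨hfs, hft⟩
  exact h0 r hr hfr

/-- A reparametrization between isothermal coordinates (with `E < 0` on
both sides) is, throughout a connected domain, either holomorphic over the double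
numbers and orientation-preserving, or anti-holomorphic and orientation-reversing —
and exactly one of the two alternatives holds. -/
theorem stmt_4 (D : Set (ℝ × ℝ)) (hD : IsOpen D) (x : ℝ × ℝ → V4)
    (hx : ContDiffOn ℝ 2 x D) (hiso : IsTimelikeIso D x)
    (D' : Set (ℝ × ℝ)) (hD' : IsOpen D') (hconn : IsConnected D')
    (p q : ℝ × ℝ → ℝ)
    (hF : ContDiffOn ℝ 1 (fun s => (p s, q s)) D')
    (hmap : Set.MapsTo (fun s => (p s, q s)) D' D)
    (hinj : Set.InjOn (fun s => (p s, q s)) D')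
    (hjac : ∀ s ∈ D', pu p s * pv q s - pv p s * pu q s ≠ 0)
    (hiso' : IsTimelikeIso D' (fun s => x (p s, q s))) :
    Xor'
      (∀ s ∈ D', pu q s = pv p s ∧ pv q s = pu p s ∧
        pu p s * pv q s - pv p s * pu q s > 0)
      (∀ s ∈ D', pu q s = -(pv p s) ∧ pv q s = -(pu p s) ∧
        pu p s * pv q s - pv p s * pu q s < 0) := by
  have hp : ContDiffOn ℝ 1 p D' := hF.fst
  have hq : ContDiffOn ℝ 1 q D' := hF.snd
  have hCR : ∀ s ∈ D',
      (pu q s = pv p s ∧ pv q s = pu p s ∧ pu p s * pv q s - pv p s * pu q s > 0) ∨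
      (pu q s = -(pv p s) ∧ pv q s = -(pu p s) ∧
        pu p s * pv q s - pv p s * pu q s < 0) := by
    intro s hs
    have hxs := (hx.contDiffAt (hD.mem_nhds (hmap hs))).differentiableAt two_ne_zero
    have hps := (hp.contDiffAt (hD'.mem_nhds hs)).differentiableAt one_ne_zero
    have hqs := (hq.contDiffAt (hD'.mem_nhds hs)).differentiableAt one_ne_zero
    have hu : pu (fun t => x (p t, q t)) s =
        pu p s • pu x (p s, q s) + pu q s • pv x (p s, q s) :=
      fderiv_comp_prodMk_apply hxs hps hqs (1, 0)
    have hv : pv (fun t => x (p t, q t)) s =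
        pv p s • pu x (p s, q s) + pv q s • pv x (p s, q s) :=
      fderiv_comp_prodMk_apply hxs hps hqs (0, 1)
    obtain ⟨hE, hG, hM⟩ := hiso _ (hmap hs)
    obtain ⟨hE', hG', hM'⟩ := hiso' s hs
    simp only [Ef, hu, hv, ip_linear_combination (e := Ef x (p s, q s)) rfl hG hM]
      at hE' hG' hM'
    refine doubleNumber_cauchyRiemann_or ?_ ?_ ?_
    · have := pos_of_mul_neg_right hE' hE.le
      linarith
    · refine mul_left_cancel₀ hE.ne ?_
      simp only [Ef]
      linear_combination hG'
    · have := (mul_eq_zero.mp hM').resolve_left hE.ne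
      linarith
  have hdet : ContinuousOn (fun s => pu p s * pv q s - pv p s * pu q s) D' := by
    have hp' := hp.continuousOn_fderiv_of_isOpen hD' le_rfl
    have hq' := hq.continuousOn_fderiv_of_isOpen hD' le_rfl
    exact ((hp'.clm_apply continuousOn_const).mul (hq'.clm_apply continuousOn_const)).sub
      ((hp'.clm_apply continuousOn_const).mul (hq'.clm_apply continuousOn_const))
  obtain ⟨s₀, hs₀⟩ := hconn.nonempty
  rcases hconn.isPreconnected.forall_pos_or_forall_neg hdet hjac with h | h
  · refine .inl ⟨fun s hs => (hCR s hs).resolve_right fun h' => ?_, fun h' => ?_⟩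
    · exact lt_asymm h'.2.2 (h s hs)
    · exact lt_asymm (h' s₀ hs₀).2.2 (h s₀ hs₀)
  · refine .inr ⟨fun s hs => (hCR s hs).resolve_left fun h' => ?_, fun h' => ?_⟩
    · exact lt_asymm h'.2.2 (h s hs)
    · exact lt_asymm (h' s₀ hs₀).2.2 (h s₀ hs₀)
end
end

section
/- (Gauss equation in isothermal coordinates) Let x : D → ℝ⁴ be a smooth minimal time-like surface in isothermal coordinates with E < 0. Then at every point of D: Δ^h ln(−E) = 2(⟨a,a⟩ − ⟨b,b⟩)/E, equivalently Δ^h ln(−E) + 2KE = 0 where K := (⟨b,b⟩ − ⟨a,a⟩)/E² is the Gauss curvature. -/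
noncomputable section

open scoped ContDiff

theorem ip_comm (a b : V4) : ip a b = ip b a := by
  unfold ip; ring

/-- Leibniz rule for the indefinite scalar product. -/
theorem fderiv_ip {f g : ℝ × ℝ → V4} {p : ℝ × ℝ} (hf : DifferentiableAt ℝ f p)
    (hg : DifferentiableAt ℝ g p) (e : ℝ × ℝ) :
    fderiv ℝ (fun s => ip (f s) (g s)) p e =
      ip (fderiv ℝ f p e) (g p) + ip (f p) (fderiv ℝ g p e) := by
  have hf' := fun i => hasFDerivAt_pi'.1 hf.hasFDerivAt i
  have hg' := fun i => hasFDerivAt_pi'.1 hg.hasFDerivAt i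
  have h := ((((hf' 0).mul (hg' 0)).neg.add ((hf' 1).mul (hg' 1))).sub
    ((hf' 2).mul (hg' 2))).add ((hf' 3).mul (hg' 3))
  have h' : fderiv ℝ (fun s => ip (f s) (g s)) p = _ := HasFDerivAt.fderiv h
  rw [h']
  simp [ip]
  ring

theorem ContDiffOn.fderiv_apply_const {F : Type*} [NormedAddCommGroup F] [NormedSpace ℝ F]
    {D : Set (ℝ × ℝ)} (hD : IsOpen D) {f : ℝ × ℝ → F} (hf : ContDiffOn ℝ ∞ f D) (e : ℝ × ℝ) :
    ContDiffOn ℝ ∞ (fun p => fderiv ℝ f p e) D :=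
  (hf.fderiv_of_isOpen hD (by simp)).clm_apply contDiffOn_const

theorem fderiv_congr_of_isOpen {F : Type*} [NormedAddCommGroup F] [NormedSpace ℝ F]
    {D : Set (ℝ × ℝ)} (hD : IsOpen D) {f g : ℝ × ℝ → F} (h : ∀ p ∈ D, f p = g p)
    {p : ℝ × ℝ} (hp : p ∈ D) : fderiv ℝ f p = fderiv ℝ g p :=
  Filter.EventuallyEq.fderiv_eq (Filter.eventuallyEq_of_mem (hD.mem_nhds hp) h)

theorem pu_pv_comm {F : Type*} [NormedAddCommGroup F] [NormedSpace ℝ F]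
    {D : Set (ℝ × ℝ)} (hD : IsOpen D) {f : ℝ × ℝ → F} (hf : ContDiffOn ℝ ∞ f D)
    {p : ℝ × ℝ} (hp : p ∈ D) : pu (pv f) p = pv (pu f) p := by
  have hf' : DifferentiableAt ℝ (fderiv ℝ f) p :=
    ((hf.fderiv_of_isOpen (m := ∞) hD (by simp)).differentiableOn (by simp)).differentiableAt
      (hD.mem_nhds hp)
  have hs : IsSymmSndFDerivAt ℝ f p :=
    (hf.contDiffAt (hD.mem_nhds hp)).isSymmSndFDerivAt
      (by simpa using WithTop.coe_le_coe.2 (le_top : (2 : ℕ∞) ≤ ⊤))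
  have h (e e' : ℝ × ℝ) :
      fderiv ℝ (fun s => fderiv ℝ f s e) p e' = fderiv ℝ (fderiv ℝ f) p e' e := by
    rw [fderiv_clm_apply hf' (differentiableAt_const e)]
    simp
  change fderiv ℝ (fun s => fderiv ℝ f s (0, 1)) p (1, 0) =
    fderiv ℝ (fun s => fderiv ℝ f s (1, 0)) p (0, 1)
  rw [h, h]
  exact hs.eq _ _

/-- Second derivative of `log (-f)` in a fixed direction. -/
theorem fderiv_fderiv_log_neg {D : Set (ℝ × ℝ)} (hD : IsOpen D) {f : ℝ × ℝ → ℝ}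
    (hf : ContDiffOn ℝ ∞ f D) (hneg : ∀ p ∈ D, f p < 0) (e : ℝ × ℝ)
    {p : ℝ × ℝ} (hp : p ∈ D) :
    fderiv ℝ (fun s => fderiv ℝ (fun t => Real.log (-(f t))) s e) p e =
      fderiv ℝ (fun s => fderiv ℝ f s e) p e / f p - (fderiv ℝ f p e) ^ 2 / f p ^ 2 := by
  have hd {g : ℝ × ℝ → ℝ} (hg : ContDiffOn ℝ ∞ g D) {q : ℝ × ℝ} (hq : q ∈ D) :
      DifferentiableAt ℝ g q :=
    (hg.differentiableOn (by simp)).differentiableAt (hD.mem_nhds hq)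
  have h1 : ∀ q ∈ D, fderiv ℝ (fun t => Real.log (-(f t))) q e =
      (f q)⁻¹ * fderiv ℝ f q e := by
    intro q hq
    simp only [Real.log_neg_eq_log]
    rw [((hd hf hq).hasFDerivAt.log (hneg q hq).ne).fderiv]
    simp
  have hne := (hneg p hp).ne
  have hinv := (hasDerivAt_inv hne).comp_hasFDerivAt p (hd hf hp).hasFDerivAt
  have h2 := hinv.mul (hd (hf.fderiv_apply_const hD e) hp).hasFDerivAt
  rw [fderiv_congr_of_isOpen hD h1 hp]
  have h3 : fderiv ℝ (fun s => (f s)⁻¹ * fderiv ℝ f s e) p = _ := h2.fderiv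
  rw [h3]
  simp
  field_simp
  ring

/-- Scalar square of a normal projection. -/
theorem ip_nproj_self {x : ℝ × ℝ → V4} {p : ℝ × ℝ} (hE : Ef x p ≠ 0)
    (hvv : ip (pv x p) (pv x p) = -(Ef x p)) (huv : ip (pu x p) (pv x p) = 0) (w : V4) :
    ip (nproj x w p) (nproj x w p) =
      ip w w - ip w (pu x p) ^ 2 / Ef x p + ip w (pv x p) ^ 2 / Ef x p := by
  have h (c d : ℝ) (X Y : V4) : ip (w - c • X + d • Y) (w - c • X + d • Y) =
      ip w w + c ^ 2 * ip X X + d ^ 2 * ip Y Y - 2 * c * ip w X + 2 * d * ip w Y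
        - 2 * c * d * ip X Y := by
    simp [ip]; ring
  have huu : ip (pu x p) (pu x p) = Ef x p := rfl
  rw [nproj, h, huu, hvv, huv]
  field_simp
  ring

/-- The Gauss equation in isothermal coordinates:
`Δʰ ln(−E) = 2(⟨a,a⟩ − ⟨b,b⟩)/E`, equivalently `Δʰ ln(−E) + 2KE = 0`. -/
theorem stmt_5 (D : Set (ℝ × ℝ)) (hD : IsOpen D) (x : ℝ × ℝ → V4)
    (hx : ContDiffOn ℝ (⊤ : ℕ∞) x D) (hiso : IsTimelikeIso D x)
    (hmin : IsMinimal D x) :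
    ∀ p ∈ D,
      hlap (fun s => Real.log (-(Ef x s))) p =
        2 * (ip (sffA x p) (sffA x p) - ip (sffB x p) (sffB x p)) / Ef x p ∧
      hlap (fun s => Real.log (-(Ef x s))) p + 2 * GaussK x p * Ef x p = 0 := by
  have hd {g : ℝ × ℝ → V4} (hg : ContDiffOn ℝ ∞ g D) {q : ℝ × ℝ} (hq : q ∈ D) :
      DifferentiableAt ℝ g q :=
    (hg.differentiableOn (by simp)).differentiableAt (hD.mem_nhds hq)
  have hu : ContDiffOn ℝ ∞ (pu x) D := hx.fderiv_apply_const hD (1, 0)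
  have hv : ContDiffOn ℝ ∞ (pv x) D := hx.fderiv_apply_const hD (0, 1)
  have huu : ContDiffOn ℝ ∞ (pu (pu x)) D := hu.fderiv_apply_const hD (1, 0)
  have hvu : ContDiffOn ℝ ∞ (pv (pu x)) D := hu.fderiv_apply_const hD (0, 1)
  have hE : ContDiffOn ℝ ∞ (Ef x) D := by
    have h (i : Fin 4) : ContDiffOn ℝ ∞ (fun s => pu x s i) D := contDiffOn_pi.1 hu i
    exact ((((h 0).mul (h 0)).neg.add ((h 1).mul (h 1))).sub ((h 2).mul (h 2))).add
      ((h 3).mul (h 3))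
  intro p hp
  have hlog := fderiv_fderiv_log_neg hD hE (fun q hq => (hiso q hq).1)
  have hEu : ∀ q ∈ D, pu (Ef x) q = 2 * ip (pu (pu x) q) (pu x q) := by
    intro q hq
    refine (fderiv_ip (hd hu hq) (hd hu hq) (1, 0)).trans ?_
    rw [ip_comm (pu x q), ← two_mul]
    rfl
  have hEv : ∀ q ∈ D, pv (Ef x) q = 2 * ip (pv (pu x) q) (pu x q) := by
    intro q hq
    refine (fderiv_ip (hd hu hq) (hd hu hq) (0, 1)).trans ?_
    rw [ip_comm (pu x q), ← two_mul]
    rfl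
  have hsecond {g : ℝ × ℝ → V4} (hg : ContDiffOn ℝ ∞ g D) (e : ℝ × ℝ) :
      fderiv ℝ (fun s => 2 * ip (g s) (pu x s)) p e =
        2 * (ip (fderiv ℝ g p e) (pu x p) + ip (g p) (fderiv ℝ (pu x) p e)) := by
    have h (s : ℝ × ℝ) : 2 * ip (g s) (pu x s) = ip ((2 : ℝ) • g s) (pu x s) := by
      simp [ip]; ring
    simp only [h]
    rw [fderiv_ip (f := fun s => (2 : ℝ) • g s) ((hd hg hp).fun_const_smul 2) (hd hu hp),
      fderiv_fun_const_smul (hd hg hp)]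
    simp [ip]; ring
  have hEuu : pu (pu (Ef x)) p =
      2 * (ip (pu (pu (pu x)) p) (pu x p) + ip (pu (pu x) p) (pu (pu x) p)) := by
    rw [pu, fderiv_congr_of_isOpen hD hEu hp]
    exact hsecond huu (1, 0)
  have hEvv : pv (pv (Ef x)) p =
      2 * (ip (pv (pv (pu x)) p) (pu x p) + ip (pv (pu x) p) (pv (pu x) p)) := by
    rw [pv, fderiv_congr_of_isOpen hD hEv hp]
    exact hsecond hvu (0, 1)
  have hthird : pv (pv (pu x)) p = pu (pu (pu x)) p := by
    have h1 : pv (pv (pu x)) p = pv (pu (pv x)) p := by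
      rw [pv, ← fderiv_congr_of_isOpen hD (fun q hq => pu_pv_comm hD hx hq) hp]
      rfl
    rw [h1, ← pu_pv_comm hD hv hp, pu,
      ← fderiv_congr_of_isOpen hD (fun q hq => sub_eq_zero.1 (hmin q hq)) hp]
    rfl
  obtain ⟨hneg, hvv, huv⟩ := hiso p hp
  have hconf (e : ℝ × ℝ) :
      ip (fderiv ℝ (pu x) p e) (pv x p) + ip (pu x p) (fderiv ℝ (pv x) p e) = 0 := by
    rw [← fderiv_ip (hd hu hp) (hd hv hp),
      fderiv_congr_of_isOpen hD (g := fun _ => (0 : ℝ)) (fun q hq => (hiso q hq).2.2) hp]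
    simp
  have hBv : ip (pv (pu x) p) (pv x p) = -ip (pu (pu x) p) (pu x p) := by
    have h := hconf (0, 1)
    change ip (pv (pu x) p) (pv x p) + ip (pu x p) (pv (pv x) p) = 0 at h
    rw [← sub_eq_zero.1 (hmin p hp), ip_comm (pu x p)] at h
    linarith
  have hAv : ip (pu (pu x) p) (pv x p) = -ip (pv (pu x) p) (pu x p) := by
    have h := hconf (1, 0)
    change ip (pu (pu x) p) (pv x p) + ip (pu x p) (pu (pv x) p) = 0 at h
    rw [pu_pv_comm hD hx hp, ip_comm (pu x p)] at h
    linarith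
  have hlap_eq : hlap (fun s => Real.log (-(Ef x s))) p =
      (pu (pu (Ef x)) p / Ef x p - pu (Ef x) p ^ 2 / Ef x p ^ 2) -
        (pv (pv (Ef x)) p / Ef x p - pv (Ef x) p ^ 2 / Ef x p ^ 2) :=
    congrArg₂ (· - ·) (hlog (1, 0) hp) (hlog (0, 1) hp)
  rw [hlap_eq, GaussK, sffA, sffB, ip_nproj_self hneg.ne hvv huv, ip_nproj_self hneg.ne hvv huv,
    hEuu, hEvv, hthird, hEu p hp, hEv p hp, hAv, hBv]
  have hne := hneg.ne
  constructor <;> field_simp <;> ring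
end
end
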